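/- For all i,j ≥ −1, all k ≥ 1, and all m ∈ {1,2}: Int ⊢ F_k^m[P_{i,j}, Q_{i,j}] ↔ A_{n+k}^m and Int ⊢ G_k^m[P_{i,j}, Q_{i,j}] ↔ B_{n+k}^m, where n = i if m = 1 and n = j if m = 2. -/

import Mathlib

namespace Paper

/-- Propositional formulas over variables indexed by ℕ, with ⊥, ∧, ∨, →. -/
inductive Fml : Type
  | var : ℕ → Fml
  | bot : Fml
  | and : Fml → Fml → Fml
  | or : Fml → Fml → Fml
  | imp : Fml → Fml → Fml

namespace Fml

/-- ¬A := A → ⊥ -/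
def neg (A : Fml) : Fml := A.imp bot

/-- A ↔ B := (A → B) ∧ (B → A) -/
def biimp (A B : Fml) : Fml := (A.imp B).and (B.imp A)

/-- The three fixed distinct variables p, q, r. -/
def p : Fml := var 0
def q : Fml := var 1
def r : Fml := var 2

/-- Applying a substitution σ to a formula. -/
def subst (σ : ℕ → Fml) : Fml → Fml
  | var n => σ n
  | bot => bot
  | and A B => and (subst σ A) (subst σ B)
  | or A B => or (subst σ A) (subst σ B)
  | imp A B => imp (subst σ A) (subst σ B)

/-- The set of variables occurring in a formula. -/
def vars : Fml → Finset ℕ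
  | var n => {n}
  | bot => ∅
  | and A B => A.vars ∪ B.vars
  | or A B => A.vars ∪ B.vars
  | imp A B => A.vars ∪ B.vars

/-- An injective encoding of formulas into ℕ. -/
def encode : Fml → ℕ
  | var n => 5 * n
  | bot => 1
  | and A B => 5 * Nat.pair A.encode B.encode + 2
  | or A B => 5 * Nat.pair A.encode B.encode + 3
  | imp A B => 5 * Nat.pair A.encode B.encode + 4

end Fml

open Fml

/-- The standard axioms of the intuitionistic propositional calculus Int. -/
def IntAx : Set Fml :=
  { p.imp (q.imp p),
    (p.imp (q.imp r)).imp ((p.imp q).imp (p.imp r)),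
    (p.and q).imp p,
    (p.and q).imp q,
    p.imp (q.imp (p.and q)),
    p.imp (p.or q),
    q.imp (p.or q),
    (p.imp r).imp ((q.imp r).imp ((p.or q).imp r)),
    (p.imp q).imp ((p.imp q.neg).imp p.neg),
    p.imp (p.neg.imp q) }

/-- Derivability in Int extended with the extra axioms Γ, with rules
    modus ponens and substitution.  `Deriv ∅ A` is `Int ⊢ A`;
    `Deriv {B} A` is `Int + B ⊢ A`. -/
inductive Deriv (Γ : Set Fml) : Fml → Prop
  | ax {A : Fml} : A ∈ IntAx → Deriv Γ A
  | extra {A : Fml} : A ∈ Γ → Deriv Γ A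
  | mp {A B : Fml} : Deriv Γ (A.imp B) → Deriv Γ A → Deriv Γ B
  | subst {A : Fml} (σ : ℕ → Fml) : Deriv Γ A → Deriv Γ (A.subst σ)

/-- (S,T) pair: `ST x n = (S_{n-2}[x], T_{n-2}[x])` (index shifted by 2). -/
def ST (x : Fml) : ℕ → Fml × Fml
  | 0 => (x.neg, x.neg.neg)
  | 1 =>
      let s := Fml.imp x.neg.neg x
      (s, s.imp (Fml.or x.neg x.neg.neg))
  | (n+2) =>
      let st1 := ST x (n+1)
      let st0 := ST x n
      let s := st1.2.imp (st1.1.or st0.2)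
      (s, s.imp (st1.1.or st1.2))

def Sf (x : Fml) (n : ℕ) : Fml := (ST x n).1
def Tf (x : Fml) (n : ℕ) : Fml := (ST x n).2

/-- `A0 n = A_{n-5}^0 = S_{n-2}[r]`, `B0 n = B_{n-5}^0` (index shifted by 5). -/
def A0 (n : ℕ) : Fml := Sf r n
def B0 (n : ℕ) : Fml := Tf r n

def C1 : Fml := A0 5
def C2 : Fml := B0 5

/-- Generic groups (A^1),(B^1) / (A^2),(B^2): `AB v c1 c2 n = (A_{n-5}, B_{n-5})`
    built over the variable `v` (index shifted by 5). -/
def AB (v c1 c2 : Fml) : ℕ → Fml × Fml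
  | 0 => (Sf v 0, Tf v 0)
  | 1 => (Sf v 1, Tf v 1)
  | 2 => (Sf v 2, Tf v 2)
  | 3 =>
      let x2 := AB v c1 c2 2
      let x1 := AB v c1 c2 1
      (x2.2.imp (x2.1.or x1.2), x2.1.imp (c1.or x2.2))
  | 4 =>
      let x3 := AB v c1 c2 3
      let x2 := AB v c1 c2 2
      (x3.2.imp (x3.1.or x2.2), x3.1.imp (x2.1.or x3.2))
  | (n+5) =>
      let x1 := AB v c1 c2 (n+4)
      let x0 := AB v c1 c2 (n+3)
      ((c2.and x1.2).imp (c1.or (x1.1.or x0.2)),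
       (c2.and x1.1).imp (c1.or (x0.1.or x1.2)))

/-- `A1 n = A_{n-5}^1` etc. (index shifted by 5). -/
def A1 (n : ℕ) : Fml := (AB p C1 C2 n).1
def B1 (n : ℕ) : Fml := (AB p C1 C2 n).2
def A2 (n : ℕ) : Fml := (AB q C2 C1 n).1
def B2 (n : ℕ) : Fml := (AB q C2 C1 n).2

/-- `AF j` is the family A^j, `BF j` the family B^j (ℕ-index shifted by 5). -/
def AF : Fin 3 → ℕ → Fml := ![A0, A1, A2]
def BF : Fin 3 → ℕ → Fml := ![B0, B1, B2]

/-- The code E_{s,m,n} of a configuration (s,m,n). -/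
def Efml (s m n : ℕ) : Fml :=
  ((A0 (3*s+7)).and ((B0 (3*s+7)).and ((A1 (m+6)).and ((B1 (m+6)).and
      ((A2 (n+6)).and (B2 (n+6))))))).imp
  ((A0 (3*s+6)).or ((B0 (3*s+6)).or ((A1 (m+5)).or ((B1 (m+5)).or
      ((A2 (n+5)).or (B2 (n+5)))))))

/-- `FG x y k = (F_k[p,q,x,y], G_k[p,q,x,y])`. -/
def FG (x y : Fml) : ℕ → Fml × Fml
  | 0 => (p, q)
  | 1 => ((y.and q).imp (x.or p), (y.and p).imp (x.or q))
  | (k+2) =>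
      let fg1 := FG x y (k+1)
      let fg0 := FG x y k
      ((y.and fg1.2).imp (x.or (fg1.1.or fg0.2)),
       (y.and fg1.1).imp (x.or (fg1.2.or fg0.1)))

/-- Key formulas F_k^1, G_k^1, F_k^2, G_k^2 (as formulas in p,q,r). -/
def F1k (k : ℕ) : Fml := (FG C1 C2 k).1
def G1k (k : ℕ) : Fml := (FG C1 C2 k).2
def F2k (k : ℕ) : Fml := (FG C2 C1 k).1
def G2k (k : ℕ) : Fml := (FG C2 C1 k).2

/-- Substituting X for p and Y for q. -/
def sub2 (X Y : Fml) (A : Fml) : Fml :=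
  A.subst (fun n => if n = 0 then X else if n = 1 then Y else var n)

/-- `Pf a b = P_{a-1,b-1}` (indices shifted by 1, so defined for all a,b:ℕ, i.e. i,j ≥ -1). -/
def Pf (a b : ℕ) : Fml :=
  (C2.imp (C1.or ((A1 (a+4)).or (B1 (a+3))))).and
  (C1.imp (C2.or ((A2 (b+4)).or (B2 (b+3)))))

/-- `Qf a b = Q_{a-1,b-1}` (indices shifted by 1). -/
def Qf (a b : ℕ) : Fml :=
  (C2.imp (C1.or ((A1 (a+3)).or (B1 (a+4))))).and
  (C1.imp (C2.or ((A2 (b+3)).or (B2 (b+4)))))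

/-- Ê_{s,i,j} (intended for i,j ≥ 1). -/
def Ehat (s i j : ℕ) : Fml :=
  ((A0 (3*s+7)).and ((B0 (3*s+7)).and ((F1k (i+1)).and ((G1k (i+1)).and
      ((F2k (j+1)).and (G2k (j+1))))))).imp
  ((A0 (3*s+6)).or ((B0 (3*s+6)).or ((F1k i).or ((G1k i).or
      ((F2k j).or (G2k j))))))

/-- Ê_{s,0,*}. -/
def Ehat0star (s : ℕ) : Fml :=
  ((A0 (3*s+7)).and ((B0 (3*s+7)).and ((A1 6).and (B1 6)))).imp
  ((A0 (3*s+6)).or ((B0 (3*s+6)).or ((A1 5).or ((B1 5).or q))))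

/-- Ê_{s,*,0}. -/
def Ehatstar0 (s : ℕ) : Fml :=
  ((A0 (3*s+7)).and ((B0 (3*s+7)).and ((A2 6).and (B2 6)))).imp
  ((A0 (3*s+6)).or ((B0 (3*s+6)).or (p.or ((A2 5).or (B2 5)))))

/-! ### Minsky machines -/

/-- Configurations (s, m, n). -/
abbrev Cfg := ℕ × ℕ × ℕ

/-- The four forms of Minsky machine instructions. -/
inductive MInstr : Type
  | inc1 (s t : ℕ)                -- s ↦ (t,1,0)
  | inc2 (s t : ℕ)                -- s ↦ (t,0,1)
  | dec1 (s t u : ℕ)              -- s ↦ (t,-1,0)/(u,0,0)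
  | dec2 (s t u : ℕ)              -- s ↦ (t,0,-1)/(u,0,0)
deriving DecidableEq

def MInstr.state : MInstr → ℕ
  | inc1 s _ => s
  | inc2 s _ => s
  | dec1 s _ _ => s
  | dec2 s _ _ => s

/-- One application of an instruction to a configuration. -/
def MInstr.step : MInstr → Cfg → Cfg → Prop
  | inc1 s t, c, c' => ∃ m n, c = (s, m, n) ∧ c' = (t, m + 1, n)
  | inc2 s t, c, c' => ∃ m n, c = (s, m, n) ∧ c' = (t, m, n + 1)
  | dec1 s t u, c, c' => ∃ m n, c = (s, m, n) ∧
      ((0 < m ∧ c' = (t, m - 1, n)) ∨ (m = 0 ∧ c' = (u, 0, n)))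
  | dec2 s t u, c, c' => ∃ m n, c = (s, m, n) ∧
      ((0 < n ∧ c' = (t, m, n - 1)) ∨ (n = 0 ∧ c' = (u, m, 0)))

/-- A Minsky machine: a finite deterministic set of instructions. -/
structure Minsky where
  instrs : List MInstr
  det : ∀ I ∈ instrs, ∀ J ∈ instrs, I.state = J.state → I = J

/-- One step of the machine. -/
def Minsky.Step (M : Minsky) (c c' : Cfg) : Prop := ∃ I ∈ M.instrs, I.step c c'

/-- (s,m,n) ⟹_𝓜 (t,k,l): reachability in finitely many (possibly zero) steps. -/
def Minsky.Reach (M : Minsky) : Cfg → Cfg → Prop := Relation.ReflTransGen M.Step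

/-- The formula Ax(I) simulating an instruction I. -/
def AxI : MInstr → Fml
  | .inc1 s t => (Ehat t 2 1).imp (Ehat s 1 1)
  | .inc2 s t => (Ehat t 1 2).imp (Ehat s 1 1)
  | .dec1 s t u => ((Ehat t 1 1).imp (Ehat s 2 1)).and ((Ehat0star u).imp (Ehat0star s))
  | .dec2 s t u => ((Ehat t 1 1).imp (Ehat s 1 2)).and ((Ehatstar0 u).imp (Ehatstar0 s))

/-- The formula Ax(𝓜): the conjunction of Ax(I) over all instructions of 𝓜. -/
def AxM (M : Minsky) : Fml := M.instrs.foldr (fun I acc => (AxI I).and acc) Fml.bot.neg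

/-! ### Kripke semantics and the frame 𝔉 -/

/-- Intuitionistic forcing over an arbitrary accessibility relation R and valuation V. -/
def Force {α : Type} (R : α → α → Prop) (V : ℕ → α → Prop) : α → Fml → Prop
  | w, Fml.var n => V n w
  | _, Fml.bot => False
  | w, Fml.and A B => Force R V w A ∧ Force R V w B
  | w, Fml.or A B => Force R V w A ∨ Force R V w B
  | w, Fml.imp A B => ∀ w', R w w' → Force R V w' A → Force R V w' B

/-- A valuation is R-upward-closed. -/
def UpClosed {α : Type} (R : α → α → Prop) (V : ℕ → α → Prop) : Prop :=
  ∀ n w w', V n w → R w w' → V n w'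

/-- The equivalence ∼_𝓜: mutual reachability. -/
def MEquiv (M : Minsky) : Setoid Cfg where
  r c c' := M.Reach c c' ∧ M.Reach c' c
  iseqv := ⟨fun _ => ⟨Relation.ReflTransGen.refl, Relation.ReflTransGen.refl⟩,
    fun h => ⟨h.2, h.1⟩, fun h h' => ⟨h.1.trans h'.1, h'.2.trans h.2⟩⟩

/-- Equivalence classes of configurations. -/
def Cl (M : Minsky) := Quotient (MEquiv M)

/-- The class [c] of a configuration c. -/
def cl (M : Minsky) (c : Cfg) : Cl M := Quotient.mk (MEquiv M) c

/-- ⟹_𝓜 lifted to equivalence classes. -/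
def ClReach (M : Minsky) (α β : Cl M) : Prop :=
  ∃ c c', cl M c = α ∧ cl M c' = β ∧ M.Reach c c'

/-- Raw points: a_i^j, b_i^j (ℕ-index n = i+5, so i ≥ -5) and e_α. -/
inductive Pt (M : Minsky) : Type
  | a (j : Fin 3) (n : ℕ)
  | b (j : Fin 3) (n : ℕ)
  | e (α : Cl M)

/-- The immediate-accessibility relation R' of the frame 𝔉 (on raw points). -/
inductive Edge (M : Minsky) (c0 : Cfg) : Pt M → Pt M → Prop
  | a4a5 (j : Fin 3) : Edge M c0 (.a j 1) (.a j 0)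
  | b4a5 (j : Fin 3) : Edge M c0 (.b j 1) (.a j 0)
  | b4b5 (j : Fin 3) : Edge M c0 (.b j 1) (.b j 0)
  | a3a4 (j : Fin 3) : Edge M c0 (.a j 2) (.a j 1)
  | a3b5 (j : Fin 3) : Edge M c0 (.a j 2) (.b j 0)
  | b3a4 (j : Fin 3) : Edge M c0 (.b j 2) (.a j 1)
  | b3b4 (j : Fin 3) : Edge M c0 (.b j 2) (.b j 1)
  -- group j = 0, i ≥ -2:
  | a0a (n : ℕ) : Edge M c0 (.a 0 (n+3)) (.a 0 (n+2))
  | a0b (n : ℕ) : Edge M c0 (.a 0 (n+3)) (.b 0 (n+1))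
  | b0a (n : ℕ) : Edge M c0 (.b 0 (n+3)) (.a 0 (n+2))
  | b0b (n : ℕ) : Edge M c0 (.b 0 (n+3)) (.b 0 (n+2))
  -- groups j = 1,2 at i = -2:
  | am2a (j : Fin 3) (h : j ≠ 0) : Edge M c0 (.a j 3) (.a j 2)
  | am2b (j : Fin 3) (h : j ≠ 0) : Edge M c0 (.a j 3) (.b j 1)
  | bm2each1 : Edge M c0 (.b 1 3) (.a 0 5)
  | bm2b1 : Edge M c0 (.b 1 3) (.b 1 2)
  | bm2each2 : Edge M c0 (.b 2 3) (.b 0 5)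
  | bm2b2 : Edge M c0 (.b 2 3) (.b 2 2)
  -- groups j = 1,2, i ≥ -1:
  | aja (j : Fin 3) (h : j ≠ 0) (n : ℕ) : Edge M c0 (.a j (n+4)) (.a j (n+3))
  | ajb (j : Fin 3) (h : j ≠ 0) (n : ℕ) : Edge M c0 (.a j (n+4)) (.b j (n+2))
  | bja (j : Fin 3) (h : j ≠ 0) (n : ℕ) : Edge M c0 (.b j (n+4)) (.a j (n+2))
  | bjb (j : Fin 3) (h : j ≠ 0) (n : ℕ) : Edge M c0 (.b j (n+4)) (.b j (n+3))
  -- group R_{s,m,n}: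
  | e1 (s m n : ℕ) (h : M.Reach c0 (s,m,n)) : Edge M c0 (.e (cl M (s,m,n))) (.a 0 (3*s+6))
  | e2 (s m n : ℕ) (h : M.Reach c0 (s,m,n)) : Edge M c0 (.e (cl M (s,m,n))) (.b 0 (3*s+6))
  | e3 (s m n : ℕ) (h : M.Reach c0 (s,m,n)) : Edge M c0 (.e (cl M (s,m,n))) (.a 1 (m+5))
  | e4 (s m n : ℕ) (h : M.Reach c0 (s,m,n)) : Edge M c0 (.e (cl M (s,m,n))) (.b 1 (m+5))
  | e5 (s m n : ℕ) (h : M.Reach c0 (s,m,n)) : Edge M c0 (.e (cl M (s,m,n))) (.a 2 (n+5))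
  | e6 (s m n : ℕ) (h : M.Reach c0 (s,m,n)) : Edge M c0 (.e (cl M (s,m,n))) (.b 2 (n+5))
  -- (e_α, e_β) whenever α ⟹ β:
  | ee (c c' : Cfg) (h : M.Reach c c') : Edge M c0 (.e (cl M c)) (.e (cl M c'))

/-- Which raw points belong to the set of worlds W. -/
def Valid (M : Minsky) (c0 : Cfg) : Pt M → Prop
  | .e α => ClReach M (cl M c0) α
  | _ => True

/-- The set of worlds W of the frame 𝔉. -/
def W (M : Minsky) (c0 : Cfg) := {x : Pt M // Valid M c0 x}

/-- The accessibility relation R of 𝔉: reflexive-transitive closure of R'. -/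
def Rel (M : Minsky) (c0 : Cfg) : W M c0 → W M c0 → Prop :=
  Relation.ReflTransGen (fun x y => Edge M c0 x.1 y.1)

/-- The point a_{n-5}^j of W. -/
def aPt (M : Minsky) (c0 : Cfg) (j : Fin 3) (n : ℕ) : W M c0 := ⟨.a j n, trivial⟩

/-- The point b_{n-5}^j of W. -/
def bPt (M : Minsky) (c0 : Cfg) (j : Fin 3) (n : ℕ) : W M c0 := ⟨.b j n, trivial⟩

/-- The point e_{[c]} of W (for a reachable configuration c). -/
def ePt (M : Minsky) (c0 : Cfg) (c : Cfg) (h : M.Reach c0 c) : W M c0 :=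
  ⟨.e (cl M c), ⟨c0, c, rfl, rfl, h⟩⟩

/-- The valuation 𝔙 of the model 𝔐 (p = var 0 ↔ group 1, q = var 1 ↔ group 2,
    r = var 2 ↔ group 0). -/
def V0 (M : Minsky) (c0 : Cfg) : ℕ → W M c0 → Prop
  | 0, w => ¬ (Rel M c0 w (aPt M c0 1 1) ∨ Rel M c0 w (bPt M c0 1 0))
  | 1, w => ¬ (Rel M c0 w (aPt M c0 2 1) ∨ Rel M c0 w (bPt M c0 2 0))
  | 2, w => ¬ (Rel M c0 w (aPt M c0 0 1) ∨ Rel M c0 w (bPt M c0 0 0))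
  | _, _ => True

end Paper
namespace Paper

open Fml

namespace Deriv

variable {Γ : Set Fml} {A B C : Fml}

/-- The substitution sending the variables `p, q, r` to `A, B, C`. -/
def inst (A B C : Fml) : ℕ → Fml
  | 0 => A
  | 1 => B
  | _ => C

theorem imp_const (A B : Fml) : Deriv Γ (A.imp (B.imp A)) :=
  Deriv.subst (inst A B A) (Deriv.ax (A := p.imp (q.imp p)) (by simp [IntAx]))

theorem imp_distrib (A B C : Fml) :
    Deriv Γ ((A.imp (B.imp C)).imp ((A.imp B).imp (A.imp C))) :=
  Deriv.subst (inst A B C)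
    (Deriv.ax (A := (p.imp (q.imp r)).imp ((p.imp q).imp (p.imp r))) (by simp [IntAx]))

theorem and_left (A B : Fml) : Deriv Γ ((A.and B).imp A) :=
  Deriv.subst (inst A B A) (Deriv.ax (A := (p.and q).imp p) (by simp [IntAx]))

theorem and_right (A B : Fml) : Deriv Γ ((A.and B).imp B) :=
  Deriv.subst (inst A B A) (Deriv.ax (A := (p.and q).imp q) (by simp [IntAx]))

theorem and_intro (A B : Fml) : Deriv Γ (A.imp (B.imp (A.and B))) :=
  Deriv.subst (inst A B A) (Deriv.ax (A := p.imp (q.imp (p.and q))) (by simp [IntAx]))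

theorem or_inl (A B : Fml) : Deriv Γ (A.imp (A.or B)) :=
  Deriv.subst (inst A B A) (Deriv.ax (A := p.imp (p.or q)) (by simp [IntAx]))

theorem or_inr (A B : Fml) : Deriv Γ (B.imp (A.or B)) :=
  Deriv.subst (inst A B A) (Deriv.ax (A := q.imp (p.or q)) (by simp [IntAx]))

theorem or_elim (A B C : Fml) :
    Deriv Γ ((A.imp C).imp ((B.imp C).imp ((A.or B).imp C))) :=
  Deriv.subst (inst A B C)
    (Deriv.ax (A := (p.imp r).imp ((q.imp r).imp ((p.or q).imp r))) (by simp [IntAx]))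

theorem imp_neg_imp (A B : Fml) : Deriv Γ (A.imp (A.neg.imp B)) :=
  Deriv.subst (inst A B A) (Deriv.ax (A := p.imp (p.neg.imp q)) (by simp [IntAx]))

theorem weaken (A : Fml) (h : Deriv Γ B) : Deriv Γ (A.imp B) :=
  (imp_const B A).mp h

theorem mp_under (h : Deriv Γ (A.imp (B.imp C))) (h' : Deriv Γ (A.imp B)) :
    Deriv Γ (A.imp C) :=
  ((imp_distrib A B C).mp h).mp h'

theorem imp_refl (A : Fml) : Deriv Γ (A.imp A) :=
  mp_under (imp_const A (A.imp A)) (imp_const A A)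

theorem imp_trans (h : Deriv Γ (A.imp B)) (h' : Deriv Γ (B.imp C)) : Deriv Γ (A.imp C) :=
  mp_under (weaken A h') h

theorem imp_and (h : Deriv Γ (A.imp B)) (h' : Deriv Γ (A.imp C)) :
    Deriv Γ (A.imp (B.and C)) :=
  mp_under (imp_trans h (and_intro B C)) h'

theorem or_imp (h : Deriv Γ (A.imp C)) (h' : Deriv Γ (B.imp C)) :
    Deriv Γ ((A.or B).imp C) :=
  ((or_elim A B C).mp h).mp h'

theorem bot_imp (A : Fml) : Deriv Γ (bot.imp A) :=
  mp_under (imp_neg_imp bot A) (weaken bot (imp_refl bot))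

theorem imp_imp_iff : Deriv Γ (A.imp (B.imp C)) ↔ Deriv Γ ((A.and B).imp C) :=
  ⟨fun h => mp_under (imp_trans (and_left A B) h) (and_right A B),
    fun h => imp_trans (and_intro A B) ((imp_distrib B (A.and B) C).mp (weaken B h))⟩

end Deriv

/-- Interderivability of formulas in `Int` extended with `Γ`. -/
def derivSetoid (Γ : Set Fml) : Setoid Fml where
  r A B := Deriv Γ (A.imp B) ∧ Deriv Γ (B.imp A)
  iseqv := ⟨fun A => ⟨Deriv.imp_refl A, Deriv.imp_refl A⟩, fun h => ⟨h.2, h.1⟩,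
    fun h h' => ⟨h.1.imp_trans h'.1, h'.2.imp_trans h.2⟩⟩

/-- The Lindenbaum algebra of `Int` extended with `Γ`. -/
def Lindenbaum (Γ : Set Fml) : Type := Quotient (derivSetoid Γ)

namespace Lindenbaum

variable {Γ : Set Fml}

/-- The class of a formula in the Lindenbaum algebra. -/
def mk (Γ : Set Fml) (A : Fml) : Lindenbaum Γ := Quotient.mk (derivSetoid Γ) A

instance : HeytingAlgebra (Lindenbaum Γ) where
  le := Quotient.lift₂ (fun A B => Deriv Γ (A.imp B)) fun _ _ _ _ h h' => propext
    ⟨fun k => (h.2.imp_trans k).imp_trans h'.1, fun k => (h.1.imp_trans k).imp_trans h'.2⟩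
  le_refl := by
    rintro ⟨A⟩
    exact Deriv.imp_refl A
  le_trans := by
    rintro ⟨A⟩ ⟨B⟩ ⟨C⟩ h h'
    exact Deriv.imp_trans h h'
  le_antisymm := by
    rintro ⟨A⟩ ⟨B⟩ h h'
    exact Quotient.sound ⟨h, h'⟩
  sup := Quotient.map₂ Fml.or fun _ _ h _ _ h' =>
    ⟨Deriv.or_imp (h.1.imp_trans (Deriv.or_inl _ _)) (h'.1.imp_trans (Deriv.or_inr _ _)),
      Deriv.or_imp (h.2.imp_trans (Deriv.or_inl _ _)) (h'.2.imp_trans (Deriv.or_inr _ _))⟩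
  le_sup_left := by
    rintro ⟨A⟩ ⟨B⟩
    exact Deriv.or_inl A B
  le_sup_right := by
    rintro ⟨A⟩ ⟨B⟩
    exact Deriv.or_inr A B
  sup_le := by
    rintro ⟨A⟩ ⟨B⟩ ⟨C⟩ h h'
    exact Deriv.or_imp h h'
  inf := Quotient.map₂ Fml.and fun _ _ h _ _ h' =>
    ⟨Deriv.imp_and ((Deriv.and_left _ _).imp_trans h.1) ((Deriv.and_right _ _).imp_trans h'.1),
      Deriv.imp_and ((Deriv.and_left _ _).imp_trans h.2) ((Deriv.and_right _ _).imp_trans h'.2)⟩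
  inf_le_left := by
    rintro ⟨A⟩ ⟨B⟩
    exact Deriv.and_left A B
  inf_le_right := by
    rintro ⟨A⟩ ⟨B⟩
    exact Deriv.and_right A B
  le_inf := by
    rintro ⟨A⟩ ⟨B⟩ ⟨C⟩ h h'
    exact Deriv.imp_and h h'
  top := mk Γ bot.neg
  le_top := by
    rintro ⟨A⟩
    exact Deriv.weaken A (Deriv.imp_refl bot)
  bot := mk Γ bot
  bot_le := by
    rintro ⟨A⟩
    exact Deriv.bot_imp A
  himp := Quotient.map₂ Fml.imp fun _ _ h _ _ h' =>
    ⟨Deriv.imp_imp_iff.2 (((Deriv.imp_and (Deriv.and_left _ _)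
        ((Deriv.and_right _ _).imp_trans h.2)).imp_trans
          (Deriv.imp_imp_iff.1 (Deriv.imp_refl _))).imp_trans h'.1),
      Deriv.imp_imp_iff.2 (((Deriv.imp_and (Deriv.and_left _ _)
        ((Deriv.and_right _ _).imp_trans h.1)).imp_trans
          (Deriv.imp_imp_iff.1 (Deriv.imp_refl _))).imp_trans h'.2)⟩
  le_himp_iff := by
    rintro ⟨A⟩ ⟨B⟩ ⟨C⟩
    exact Deriv.imp_imp_iff
  compl := Quotient.map Fml.neg fun _ _ h =>
    ⟨Deriv.imp_imp_iff.2 ((Deriv.imp_and (Deriv.and_left _ _)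
        ((Deriv.and_right _ _).imp_trans h.2)).imp_trans
          (Deriv.imp_imp_iff.1 (Deriv.imp_refl _))),
      Deriv.imp_imp_iff.2 ((Deriv.imp_and (Deriv.and_left _ _)
        ((Deriv.and_right _ _).imp_trans h.1)).imp_trans
          (Deriv.imp_imp_iff.1 (Deriv.imp_refl _)))⟩
  himp_bot := by
    rintro ⟨A⟩
    rfl

theorem deriv_biimp_of_mk_eq {A B : Fml} (h : mk Γ A = mk Γ B) : Deriv Γ (A.biimp B) :=
  have h' := Quotient.exact (s := derivSetoid Γ) h
  ((Deriv.and_intro _ _).mp h'.1).mp h'.2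

end Lindenbaum

section Heyting

variable {α : Type*} [HeytingAlgebra α] {c d u u' v v' : α}

theorem inf_himp_sup_congr (hu : c ⊓ u = c ⊓ u') (hv : c ⊓ v = c ⊓ v') :
    c ⊓ u ⇨ d ⊔ v = c ⊓ u' ⇨ d ⊔ v' := by
  have key (w : α) : c ⊓ u' ⇨ d ⊔ w = c ⊓ u' ⇨ c ⊓ (d ⊔ w) := by
    rw [himp_inf_distrib, himp_eq_top_iff.2 inf_le_left, top_inf_eq]
  rw [hu, key v, key v', inf_sup_left, hv, ← inf_sup_left]

theorem inf_himp_inf_himp_sup (c s t d : α) : c ⊓ ((c ⇨ s) ⊓ (d ⇨ c ⊔ t)) = c ⊓ s := by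
  rw [← inf_assoc, inf_himp, inf_assoc, inf_comm s, ← inf_assoc,
    inf_eq_left.2 (le_himp_iff.2 (inf_le_left.trans le_sup_left))]

theorem inf_sup_sup_himp_sup_sup {a₀ a₁ b₀ b₁ : α} (ha : a₀ ≤ a₁) :
    c ⊓ (d ⊔ (a₀ ⊔ b₁)) ⇨ d ⊔ (d ⊔ (a₁ ⊔ b₀)) = c ⊓ b₁ ⇨ d ⊔ (a₁ ⊔ b₀) := by
  have ha' : a₀ ≤ d ⊔ (a₁ ⊔ b₀) := (ha.trans le_sup_left).trans le_sup_right
  rw [← sup_assoc d d, sup_idem, inf_sup_left, inf_sup_left, sup_himp_distrib, sup_himp_distrib,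
    himp_eq_top_iff.2 (inf_le_right.trans le_sup_left),
    himp_eq_top_iff.2 (inf_le_right.trans ha'), top_inf_eq, top_inf_eq]

theorem inf_sup_congr_right (h : c ⊓ v = c ⊓ v') : c ⊓ (u ⊔ v) = c ⊓ (u ⊔ v') := by
  rw [inf_sup_left, h, ← inf_sup_left]

theorem sup_sup_sup_sup_absorb {a₀ a b : α} (h : a₀ ≤ a) :
    d ⊔ (a ⊔ (d ⊔ (a₀ ⊔ b))) = d ⊔ (a ⊔ b) := by
  rw [sup_left_comm a d, ← sup_assoc d d, sup_idem, ← sup_assoc a, sup_eq_left.2 h]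

end Heyting

open Lindenbaum

theorem mk_inf_mk_imp_and_imp (Γ : Set Fml) (A B C D : Fml) :
    mk Γ A ⊓ mk Γ ((A.imp B).and (C.imp (A.or D))) = mk Γ A ⊓ mk Γ B :=
  inf_himp_inf_himp_sup (mk Γ A) (mk Γ B) (mk Γ D) (mk Γ C)

theorem mk_inf_mk_imp_and_imp_comm (Γ : Set Fml) (A B C D : Fml) :
    mk Γ A ⊓ mk Γ ((C.imp (A.or D)).and (A.imp B)) = mk Γ A ⊓ mk Γ B := by
  rw [← mk_inf_mk_imp_and_imp Γ A B C D]
  exact congrArg _ (inf_comm (mk Γ (C.imp (A.or D))) (mk Γ (A.imp B)))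

theorem mk_AB_fst (Γ : Set Fml) (v c₁ c₂ : Fml) (n : ℕ) :
    mk Γ (AB v c₁ c₂ (n + 5)).1 = mk Γ c₂ ⊓ mk Γ (AB v c₁ c₂ (n + 4)).2 ⇨
      mk Γ c₁ ⊔ (mk Γ (AB v c₁ c₂ (n + 4)).1 ⊔ mk Γ (AB v c₁ c₂ (n + 3)).2) := rfl

theorem mk_AB_snd (Γ : Set Fml) (v c₁ c₂ : Fml) (n : ℕ) :
    mk Γ (AB v c₁ c₂ (n + 5)).2 = mk Γ c₂ ⊓ mk Γ (AB v c₁ c₂ (n + 4)).1 ⇨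
      mk Γ c₁ ⊔ (mk Γ (AB v c₁ c₂ (n + 3)).1 ⊔ mk Γ (AB v c₁ c₂ (n + 4)).2) := rfl

theorem mk_AB_fst_mono (Γ : Set Fml) (v c₁ c₂ : Fml) (n : ℕ) :
    mk Γ (AB v c₁ c₂ (n + 3)).1 ≤ mk Γ (AB v c₁ c₂ (n + 4)).1 := by
  rcases n with _ | n
  · change _ ≤ mk Γ (AB v c₁ c₂ 3).2 ⇨ mk Γ (AB v c₁ c₂ 3).1 ⊔ mk Γ (AB v c₁ c₂ 2).2
    exact le_himp_iff.2 (inf_le_left.trans le_sup_left)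
  · rw [mk_AB_fst Γ v c₁ c₂ n]
    exact le_himp_iff.2 (inf_le_left.trans (le_sup_left.trans le_sup_right))

theorem mk_AB_snd_mono (Γ : Set Fml) (v c₁ c₂ : Fml) (n : ℕ) :
    mk Γ (AB v c₁ c₂ (n + 3)).2 ≤ mk Γ (AB v c₁ c₂ (n + 4)).2 := by
  rcases n with _ | n
  · change _ ≤ mk Γ (AB v c₁ c₂ 3).1 ⇨ mk Γ (AB v c₁ c₂ 2).1 ⊔ mk Γ (AB v c₁ c₂ 3).2
    exact le_himp_iff.2 (inf_le_left.trans le_sup_right)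
  · rw [mk_AB_snd Γ v c₁ c₂ n]
    exact le_himp_iff.2 (inf_le_left.trans (le_sup_right.trans le_sup_right))

theorem mk_sub2_inf_imp_or {Γ : Set Fml} {x y X Y : Fml}
    (hx : sub2 X Y x = x) (hy : sub2 X Y y = y) (A B : Fml) :
    mk Γ (sub2 X Y ((y.and A).imp (x.or B))) =
      mk Γ y ⊓ mk Γ (sub2 X Y A) ⇨ mk Γ x ⊔ mk Γ (sub2 X Y B) := by
  have h : sub2 X Y ((y.and A).imp (x.or B)) =
      ((sub2 X Y y).and (sub2 X Y A)).imp ((sub2 X Y x).or (sub2 X Y B)) := rfl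
  rw [h, hx, hy]
  rfl

/-- Substituting for `p` and `q` formulas which, below `y`, agree with `x ∨ A_n ∨ B_{n-1}` and
`x ∨ A_{n-1} ∨ B_n` turns the sequence `F_k, G_k` into a shift of the sequence `A_n, B_n`. -/
theorem mk_sub2_FG {Γ : Set Fml} {v x y X Y : Fml} {n : ℕ}
    (hx : sub2 X Y x = x) (hy : sub2 X Y y = y)
    (hX : mk Γ y ⊓ mk Γ X =
      mk Γ y ⊓ (mk Γ x ⊔ (mk Γ (AB v x y (n + 4)).1 ⊔ mk Γ (AB v x y (n + 3)).2)))
    (hY : mk Γ y ⊓ mk Γ Y =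
      mk Γ y ⊓ (mk Γ x ⊔ (mk Γ (AB v x y (n + 3)).1 ⊔ mk Γ (AB v x y (n + 4)).2)))
    (k : ℕ) :
    mk Γ (sub2 X Y (FG x y (k + 1)).1) = mk Γ (AB v x y (n + k + 5)).1 ∧
    mk Γ (sub2 X Y (FG x y (k + 1)).2) = mk Γ (AB v x y (n + k + 5)).2 := by
  have hA := mk_AB_fst_mono Γ v x y n
  have hB := mk_AB_snd_mono Γ v x y n
  have hA' := hA.trans (mk_AB_fst_mono Γ v x y (n + 1))
  have hB' := hB.trans (mk_AB_snd_mono Γ v x y (n + 1))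
  have hF (k : ℕ) : mk Γ (sub2 X Y (FG x y (k + 2)).1) =
      mk Γ y ⊓ mk Γ (sub2 X Y (FG x y (k + 1)).2) ⇨
        mk Γ x ⊔ (mk Γ (sub2 X Y (FG x y (k + 1)).1) ⊔ mk Γ (sub2 X Y (FG x y k).2)) :=
    mk_sub2_inf_imp_or hx hy _ _
  have hG (k : ℕ) : mk Γ (sub2 X Y (FG x y (k + 2)).2) =
      mk Γ y ⊓ mk Γ (sub2 X Y (FG x y (k + 1)).1) ⇨
        mk Γ x ⊔ (mk Γ (sub2 X Y (FG x y (k + 1)).2) ⊔ mk Γ (sub2 X Y (FG x y k).1)) :=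
    mk_sub2_inf_imp_or hx hy _ _
  have hX₀ : mk Γ y ⊓ mk Γ (sub2 X Y (FG x y 0).1) =
    mk Γ y ⊓ (mk Γ x ⊔ (mk Γ (AB v x y (n + 4)).1 ⊔ mk Γ (AB v x y (n + 3)).2)) := hX
  have hY₀ : mk Γ y ⊓ mk Γ (sub2 X Y (FG x y 0).2) =
    mk Γ y ⊓ (mk Γ x ⊔ (mk Γ (AB v x y (n + 3)).1 ⊔ mk Γ (AB v x y (n + 4)).2)) := hY
  have base : mk Γ (sub2 X Y (FG x y 1).1) = mk Γ (AB v x y (n + 5)).1 ∧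
      mk Γ (sub2 X Y (FG x y 1).2) = mk Γ (AB v x y (n + 5)).2 := by
    constructor
    · refine (mk_sub2_inf_imp_or hx hy q p).trans ((inf_himp_sup_congr hY hX).trans ?_)
      exact inf_sup_sup_himp_sup_sup hA
    · refine (mk_sub2_inf_imp_or hx hy p q).trans ((inf_himp_sup_congr hX hY).trans ?_)
      rw [mk_AB_snd, sup_comm (mk Γ (AB v x y (n + 4)).1), sup_comm (mk Γ (AB v x y (n + 3)).1)]
      exact inf_sup_sup_himp_sup_sup hB
  induction k using Nat.twoStepInduction with
  | zero => exact base
  | one =>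
    constructor
    · rw [hF 0, base.1, base.2, inf_himp_sup_congr rfl (inf_sup_congr_right hY₀),
        sup_sup_sup_sup_absorb hA']
      rfl
    · rw [hG 0, base.1, base.2, inf_himp_sup_congr rfl (inf_sup_congr_right hX₀),
        sup_comm (mk Γ (AB v x y (n + 4)).1), sup_sup_sup_sup_absorb hB',
        sup_comm (mk Γ (AB v x y (n + 5)).2)]
      rfl
  | more k ih ih' =>
    constructor
    · rw [hF (k + 1), ih'.1, ih'.2, ih.2]
      rfl
    · rw [hG (k + 1), ih'.1, ih'.2, ih.1, sup_comm (mk Γ (AB v x y (n + (k + 1) + 5)).2)]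
      rfl

end Paper

open Paper in
/-- for all i,j ≥ -1 (ℕ-indices a = i+1, b = j+1), k ≥ 1, m ∈ {1,2}:
    Int ⊢ F_k^m[P_{i,j},Q_{i,j}] ↔ A_{n+k}^m and Int ⊢ G_k^m[P_{i,j},Q_{i,j}] ↔ B_{n+k}^m
    (n = i for m = 1, n = j for m = 2; A/B-indices shifted by 5: n+k ↦ a+k+4 resp. b+k+4). -/
theorem statement5 (a b k : ℕ) (hk : 1 ≤ k) :
    (Deriv ∅ ((sub2 (Pf a b) (Qf a b) (F1k k)).biimp (A1 (a + k + 4))) ∧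
     Deriv ∅ ((sub2 (Pf a b) (Qf a b) (G1k k)).biimp (B1 (a + k + 4)))) ∧
    (Deriv ∅ ((sub2 (Pf a b) (Qf a b) (F2k k)).biimp (A2 (b + k + 4))) ∧
     Deriv ∅ ((sub2 (Pf a b) (Qf a b) (G2k k)).biimp (B2 (b + k + 4)))) := by
  obtain ⟨k, rfl⟩ := Nat.exists_eq_add_of_le' hk
  have h₁ := mk_sub2_FG (Γ := ∅) (v := Fml.p) (n := a) (X := Pf a b) (Y := Qf a b)
    (show sub2 _ _ C1 = C1 from rfl) (show sub2 _ _ C2 = C2 from rfl)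
    (mk_inf_mk_imp_and_imp _ _ _ _ _) (mk_inf_mk_imp_and_imp _ _ _ _ _) k
  have h₂ := mk_sub2_FG (Γ := ∅) (v := Fml.q) (n := b) (X := Pf a b) (Y := Qf a b)
    (show sub2 _ _ C2 = C2 from rfl) (show sub2 _ _ C1 = C1 from rfl)
    (mk_inf_mk_imp_and_imp_comm _ _ _ _ _) (mk_inf_mk_imp_and_imp_comm _ _ _ _ _) k
  rw [← Nat.add_assoc a, ← Nat.add_assoc b]
  exact ⟨⟨Lindenbaum.deriv_biimp_of_mk_eq h₁.1, Lindenbaum.deriv_biimp_of_mk_eq h₁.2⟩,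
    Lindenbaum.deriv_biimp_of_mk_eq h₂.1, Lindenbaum.deriv_biimp_of_mk_eq h₂.2⟩
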